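/- Let B be a block of k⟦G⟧ with non-trivial cyclic defect group D, let S be a simple B-module with projective cover P = P_S, and let N be an open normal subgroup of G acting trivially on every simple B-module, belonging to the cofinal system 𝒩. Then the coinvariant module P_N is non-zero and indecomposable as a k[G/N]-module; moreover P_N is the projective cover of S regarded as a k[G/N]-module. -/

import Mathlib

open scoped Classical
set_option maxHeartbeats 1000000
set_option synthInstance.maxHeartbeats 400000

noncomputable section

namespace ProfiniteBlocks

variable (k : Type) [Field k] (G : Type) [Group G] [TopologicalSpace G]

/-- Discrete topology on each finite level group algebra. -/
instance (X : Type) : TopologicalSpace (MonoidAlgebra k X) := ⊥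

/-- The canonical quotient homomorphism `G/N → G/M` for `N ≤ M`. -/
def qHom (N M : OpenNormalSubgroup G) (h : N ≤ M) :
    G ⧸ N.toSubgroup →* G ⧸ M.toSubgroup :=
  QuotientGroup.map _ _ (MonoidHom.id G) (fun x hx => h hx)

/-- The induced algebra homomorphism `k[G/N] → k[G/M]` for `N ≤ M`. -/
def tHom (N M : OpenNormalSubgroup G) (h : N ≤ M) :
    MonoidAlgebra k (G ⧸ N.toSubgroup) →ₐ[k] MonoidAlgebra k (G ⧸ M.toSubgroup) :=
  MonoidAlgebra.mapDomainAlgHom k k (qHom G N M h)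

/-- The completed group algebra `k⟦G⟧`, realized as the inverse limit of the finite
level group algebras `k[G/N]` over all open normal subgroups `N` of `G`, sitting inside
their product. -/
def CGA : Subalgebra k (∀ N : OpenNormalSubgroup G, MonoidAlgebra k (G ⧸ N.toSubgroup)) where
  carrier := {x | ∀ (N M : OpenNormalSubgroup G) (h : N ≤ M), tHom k G N M h (x N) = x M}
  add_mem' hx hy N M h := by simp [map_add, hx N M h, hy N M h]
  mul_mem' hx hy N M h := by simp [map_mul, hx N M h, hy N M h]
  algebraMap_mem' r N M h := by
    simp [tHom, MonoidAlgebra.mapDomainAlgHom, MonoidAlgebra.mapDomainRingHom,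
      Finsupp.mapDomain_single]

instance : Ring (CGA k G) := inferInstance
instance : Algebra k (CGA k G) := inferInstance

/-- `k⟦G⟧` carries the inverse limit topology (each `k[G/N]` being discrete). -/
instance : TopologicalSpace (CGA k G) := inferInstanceAs (TopologicalSpace (Subtype _))

/-- The canonical (continuous) inclusion of `G` into `k⟦G⟧`. -/
def ofG : G →* CGA k G where
  toFun g := ⟨fun N => MonoidAlgebra.single ((g : G) : G ⧸ N.toSubgroup) 1, by
    intro N M h
    simp [tHom, MonoidAlgebra.mapDomainAlgHom, MonoidAlgebra.mapDomainRingHom,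
      Finsupp.mapDomain_single, qHom, QuotientGroup.map_mk]
    rfl⟩
  map_one' := by
    ext N
    simp [MonoidAlgebra.one_def]
  map_mul' g g' := by
    ext N
    simp [MonoidAlgebra.single_mul_single]


/-- The map between quotient modules induced by `f` (the canonical map whenever
`f` carries `P` into `Q`). -/
def mapQ' {R X Y : Type} [Ring R] [AddCommGroup X] [AddCommGroup Y] [Module R X]
    [Module R Y] (P : Submodule R X) (Q : Submodule R Y) (f : X →ₗ[R] Y) :
    (X ⧸ P) →ₗ[R] (Y ⧸ Q) :=
  if h : P ≤ Q.comap f then Submodule.mapQ P Q f h else 0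

/-- The map between submodules induced by `f` (the canonical restriction whenever
`f` carries `P` into `Q`). -/
def restrict' {R X Y : Type} [Ring R] [AddCommGroup X] [AddCommGroup Y] [Module R X]
    [Module R Y] (P : Submodule R X) (Q : Submodule R Y) (f : X →ₗ[R] Y) :
    P →ₗ[R] Q :=
  if h : ∀ x ∈ P, f x ∈ Q then f.restrict h else 0

/-- The subquotient `W / W'` of a module. -/
abbrev subQuot {R X : Type} [Ring R] [AddCommGroup X] [Module R X]
    (W W' : Submodule R X) : Type :=
  W ⧸ (W'.comap W.subtype)

/-- The radical of a topological module: the intersection of its maximal open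
submodules. -/
def radical (R : Type) [Ring R] (X : Type) [AddCommGroup X] [Module R X]
    [TopologicalSpace X] : Submodule R X :=
  sInf {W : Submodule R X | IsCoatom W ∧ IsOpen (W : Set X)}

/-- Iterated radicals `Rad^i(X)`, with `Rad^0(X) = X`. -/
def radPow (R : Type) [Ring R] (X : Type) [AddCommGroup X] [Module R X]
    [TopologicalSpace X] : ℕ → Submodule R X
  | 0 => ⊤
  | (n + 1) => (radical R (radPow R X n)).map (radPow R X n).subtype

/-- A topological module is semisimple if every closed submodule has a closed
complement. -/
def IsSemisimpleTop (R : Type) [Ring R] (X : Type) [AddCommGroup X] [Module R X]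
    [TopologicalSpace X] : Prop :=
  ∀ W : Submodule R X, IsClosed (W : Set X) →
    ∃ W' : Submodule R X, IsClosed (W' : Set X) ∧ IsCompl W W'

/-- The socle of a topological module: the largest closed semisimple submodule
(defined as the join of all closed semisimple submodules). -/
def socle (R : Type) [Ring R] (X : Type) [AddCommGroup X] [Module R X]
    [TopologicalSpace X] : Submodule R X :=
  sSup {W : Submodule R X | IsClosed (W : Set X) ∧ IsSemisimpleTop R W}

/-- A module is uniserial if its submodules form a chain. -/
def Uniserial (R : Type) [Ring R] (X : Type) [AddCommGroup X] [Module R X] : Prop :=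
  ∀ W W' : Submodule R X, W ≤ W' ∨ W' ≤ W

/-- A topological module is (topologically) indecomposable if it is non-zero and
admits no non-trivial decomposition into closed direct summands. -/
def IsIndecTop (R : Type) [Ring R] (X : Type) [AddCommGroup X] [Module R X]
    [TopologicalSpace X] : Prop :=
  Nontrivial X ∧ ∀ W W' : Submodule R X, IsClosed (W : Set X) → IsClosed (W' : Set X) →
    IsCompl W W' → W = ⊥ ∨ W' = ⊥

/-- The inverse limit of a compatible system of modules indexed by a preorder,
realized as the submodule of compatible families in the product. -/
def compatLim {ι : Type} [Preorder ι] {R : Type} [Ring R] (T : ι → Type)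
    [∀ i, AddCommGroup (T i)] [∀ i, Module R (T i)]
    (t : ∀ i j, i ≤ j → (T i →ₗ[R] T j)) : Submodule R (∀ i, T i) where
  carrier := {f | ∀ (i j : ι) (h : i ≤ j), t i j h (f i) = f j}
  add_mem' ha hb i j h := by simp only [Pi.add_apply, map_add]; rw [ha i j h, hb i j h]
  zero_mem' i j h := by simp
  smul_mem' c a ha i j h := by simp only [Pi.smul_apply, map_smul]; rw [ha i j h]

/-- `X` has exactly `n` composition factors (measured along the radical series). -/
def HasNFactors (R : Type) [Ring R] (X : Type) [AddCommGroup X] [Module R X]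
    [TopologicalSpace X] (n : ℕ) : Prop :=
  radPow R X n = ⊥ ∧ ∀ m < n, radPow R X m ≠ ⊥

/-- `X` has infinitely many composition factors. -/
def HasInfFactors (R : Type) [Ring R] (X : Type) [AddCommGroup X] [Module R X]
    [TopologicalSpace X] : Prop :=
  ∀ n : ℕ, radPow R X n ≠ ⊥



section Coinvariants

variable {k : Type} [Field k] {G : Type} [Group G] [TopologicalSpace G]

variable (k G) in
/-- The (closed) submodule `I_N U` of a topological `k⟦G⟧`-module `U`: the smallest
closed submodule containing all elements `n • u - u` for `n ∈ N`.  Its quotient is the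
module of `N`-coinvariants. -/
def coinvKer (N : OpenNormalSubgroup G) (U : Type) [AddCommGroup U]
    [Module (CGA k G) U] [TopologicalSpace U] : Submodule (CGA k G) U :=
  sInf {W : Submodule (CGA k G) U | IsClosed (W : Set U) ∧
    ∀ n ∈ N.toSubgroup, ∀ u : U, ofG k G n • u - u ∈ W}

variable (k G) in
/-- The module of `N`-coinvariants `U_N` of a topological `k⟦G⟧`-module `U`. -/
abbrev coinv (N : OpenNormalSubgroup G) (U : Type) [AddCommGroup U]
    [Module (CGA k G) U] [TopologicalSpace U] : Type :=
  U ⧸ coinvKer k G N U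

variable (k G) in
/-- The canonical projection `φ_N : U → U_N`. -/
def phi (N : OpenNormalSubgroup G) (U : Type) [AddCommGroup U]
    [Module (CGA k G) U] [TopologicalSpace U] : U →ₗ[CGA k G] coinv k G N U :=
  (coinvKer k G N U).mkQ

lemma coinvKer_mono {N M : OpenNormalSubgroup G} (h : N ≤ M) (U : Type) [AddCommGroup U]
    [Module (CGA k G) U] [TopologicalSpace U] : coinvKer k G N U ≤ coinvKer k G M U :=
  sInf_le_sInf (fun W hW => ⟨hW.1, fun n hn u => hW.2 n (h hn) u⟩)

variable (k G) in
/-- The canonical projection `φ_{MN} : U_N → U_M` for `N ≤ M`. -/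
def phiT (N M : OpenNormalSubgroup G) (h : N ≤ M) (U : Type) [AddCommGroup U]
    [Module (CGA k G) U] [TopologicalSpace U] :
    coinv k G N U →ₗ[CGA k G] coinv k G M U :=
  Submodule.mapQ _ _ LinearMap.id (fun _ hx => coinvKer_mono h U hx)

variable (k G) in
/-- `N` acts trivially on the `k⟦G⟧`-module `W`. -/
def NTrivial (N : OpenNormalSubgroup G) (W : Type) [AddCommGroup W]
    [Module (CGA k G) W] : Prop :=
  ∀ n ∈ N.toSubgroup, ∀ w : W, ofG k G n • w = w

end Coinvariants

section Pseudocompact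

variable (k : Type) [Field k]

/-- A pseudocompact module over a topological `k`-algebra `A`: a Hausdorff topological
module possessing a basis of neighbourhoods of `0` consisting of open submodules of
finite codimension which intersect in `0`, and which is the inverse limit of the
corresponding discrete quotients. -/
structure IsPseudocompactMod (A : Type) [Ring A] [Algebra k A] [TopologicalSpace A]
    (X : Type) [AddCommGroup X] [Module k X] [Module A X] [IsScalarTower k A X]
    [TopologicalSpace X] : Prop where
  t2 : T2Space X
  addGroup : IsTopologicalAddGroup X
  contSMul : ContinuousSMul A X
  basis : (nhds (0 : X)).HasBasis
    (fun V : Submodule A X => IsOpen (V : Set X) ∧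
      FiniteDimensional k (X ⧸ V.restrictScalars k))
    (fun V => (V : Set X))
  inf_bot : (⨅ (V : Submodule A X) (_ : IsOpen (V : Set X) ∧
      FiniteDimensional k (X ⧸ V.restrictScalars k)), V) = ⊥
  complete : ∀ c : ∀ V : {V : Submodule A X // IsOpen (V : Set X) ∧
      FiniteDimensional k (X ⧸ V.restrictScalars k)}, X ⧸ V.1,
    (∀ (V W : {V : Submodule A X // IsOpen (V : Set X) ∧
        FiniteDimensional k (X ⧸ V.restrictScalars k)}), V.1 ≤ W.1 →
      mapQ' V.1 W.1 LinearMap.id (c V) = c W) →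
    ∃ x : X, ∀ V, c V = Submodule.Quotient.mk x

end Pseudocompact

section Blocks

variable (R : Type) [Ring R]

/-- A block idempotent: a centrally primitive idempotent of `R`. -/
structure IsBlockIdem (e : R) : Prop where
  idem : IsIdempotentElem e
  ne_zero : e ≠ 0
  central : e ∈ Set.center R
  primitive : ∀ f g : R, f ∈ Set.center R → g ∈ Set.center R → IsIdempotentElem f →
    IsIdempotentElem g → f * g = 0 → g * f = 0 → e = f + g → f = 0 ∨ g = 0

/-- The block `B = Re` determined by a central idempotent `e`, as a left `R`-module. -/
def blockMod (e : R) (he : e ∈ Set.center R) : Submodule R R where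
  carrier := {a : R | a * e = a}
  add_mem' := by intro a b ha hb; simp only [Set.mem_setOf_eq, add_mul] at *; rw [ha, hb]
  zero_mem' := by simp
  smul_mem' := by
    intro c a ha
    simp only [Set.mem_setOf_eq, smul_eq_mul, mul_assoc] at *
    rw [ha]

/-- A module belongs to the block of the central idempotent `e` if `e` acts as the
identity on it. -/
def InBlock {X : Type} [AddCommGroup X] [Module R X] (e : R) : Prop :=
  ∀ x : X, e • x = x

end Blocks

section Defect

variable {k : Type} [Field k] {G : Type} [Group G] [TopologicalSpace G]

variable (k G) in
/-- The conjugation action of `G` on `k⟦G⟧`. -/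
def conjAct (g : G) (x : CGA k G) : CGA k G :=
  ofG k G g * x * ofG k G g⁻¹

variable (k G) in
/-- The `H`-fixed points of `k⟦G⟧` under conjugation. -/
def fixedBy (H : Subgroup G) : Set (CGA k G) :=
  {x : CGA k G | ∀ h ∈ H, conjAct k G h x = x}

variable (k G) in
/-- The relative trace map `Tr_H^G` on `k⟦G⟧` (a finite sum over coset
representatives when `H` is open). -/
def trMap (H : Subgroup G) (x : CGA k G) : CGA k G :=
  ∑ᶠ c : G ⧸ H, conjAct k G (Quotient.out c) x

variable (k G) in
/-- The image `Tr_H^G(k⟦G⟧^H)`. -/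
def trImage (H : Subgroup G) : Set (CGA k G) :=
  trMap k G H '' fixedBy k G H

variable (k G) in
/-- `D` satisfies the defect property for `e`:
`e ∈ ⋂_N Tr_{DN}^G (k⟦G⟧^{DN})`. -/
def DefectProp (e : CGA k G) (D : Subgroup G) : Prop :=
  ∀ N : OpenNormalSubgroup G, e ∈ trImage k G (D ⊔ N.toSubgroup)

variable (k G) in
/-- `D` is a defect group of the block of `e`: a closed subgroup, minimal subject to
the defect property. -/
structure IsDefectGroup (e : CGA k G) (D : Subgroup G) : Prop where
  closed : IsClosed (D : Set G)
  defect : DefectProp k G e D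
  minimal : ∀ D' : Subgroup G, IsClosed ((D' : Set G)) → D' ≤ D →
    DefectProp k G e D' → D' = D

end Defect

section FiniteDefect

variable (k : Type) [Field k] (Q : Type) [Group Q]

/-- Conjugation on a finite level group algebra `k[Q]`. -/
def conjActF (q : Q) (x : MonoidAlgebra k Q) : MonoidAlgebra k Q :=
  MonoidAlgebra.single q 1 * x * MonoidAlgebra.single q⁻¹ 1

/-- `H`-fixed points of `k[Q]` under conjugation. -/
def fixedByF (H : Subgroup Q) : Set (MonoidAlgebra k Q) :=
  {x | ∀ h ∈ H, conjActF k Q h x = x}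

/-- The relative trace map `Tr_H^Q` on `k[Q]`. -/
def trMapF (H : Subgroup Q) (x : MonoidAlgebra k Q) : MonoidAlgebra k Q :=
  ∑ᶠ c : Q ⧸ H, conjActF k Q (Quotient.out c) x

/-- The image `Tr_H^Q(k[Q]^H)`. -/
def trImageF (H : Subgroup Q) : Set (MonoidAlgebra k Q) :=
  trMapF k Q H '' fixedByF k Q H

/-- `Dq` is a defect group of the block of `e` in the group algebra `k[Q]`. -/
structure IsDefectGroupF (e : MonoidAlgebra k Q) (Dq : Subgroup Q) : Prop where
  defect : e ∈ trImageF k Q Dq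
  minimal : ∀ D' : Subgroup Q, D' ≤ Dq → e ∈ trImageF k Q D' → D' = Dq

end FiniteDefect

section CyclicDefect

variable {k : Type} [Field k] {G : Type} [Group G] [TopologicalSpace G]

variable (G) in
/-- A subgroup is procyclic if it possesses a dense cyclic (abstract) subgroup. -/
def IsProcyclic (D : Subgroup G) : Prop :=
  ∃ g : G, closure ((Subgroup.zpowers g : Subgroup G) : Set G) = (D : Set G)

variable (G) in
/-- `D` is isomorphic, as a topological group, to the `p`-adic integers `ℤ_p`. -/
def IsZpGroup (p : ℕ) [Fact p.Prime] (D : Subgroup G) : Prop :=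
  ∃ φ : D ≃ₜ Multiplicative ℤ_[p], ∀ x y : D, φ (x * y) = φ x * φ y

variable (G) in
/-- `D` is a cyclic pro-`p` group: either a finite cyclic `p`-group or `ℤ_p`. -/
def IsCyclicProP (p : ℕ) [Fact p.Prime] (D : Subgroup G) : Prop :=
  (Finite D ∧ IsPGroup p D ∧ IsCyclic D) ∨ IsZpGroup G p D

end CyclicDefect

section Simples

variable {k : Type} [Field k] {G : Type} [Group G] [TopologicalSpace G]

variable (k G) in
/-- The projection `k⟦G⟧ → k[G/N]`. -/
def projN (N : OpenNormalSubgroup G) (x : CGA k G) :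
    MonoidAlgebra k (G ⧸ N.toSubgroup) :=
  (x : ∀ N : OpenNormalSubgroup G, MonoidAlgebra k (G ⧸ N.toSubgroup)) N

variable (k G) in
/-- `N` acts trivially on every simple module of the block of `e`. -/
def TrivOnSimples (e : CGA k G) (N : OpenNormalSubgroup G) : Prop :=
  ∀ (S : Type) [AddCommGroup S] [Module (CGA k G) S],
    IsSimpleModule (CGA k G) S → InBlock (CGA k G) (X := S) e → NTrivial k G N S

variable (k G) in
/-- Membership of `N` in the standard cofinal system `𝒩` for the block `B` of `e`
with defect group `D`: the coinvariant algebra `B_N` is a block of `k[G/N]` with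
defect group `DN/N`, and `N` acts trivially on every simple `B`-module. -/
structure GoodN (e : CGA k G) (D : Subgroup G) (N : OpenNormalSubgroup G) : Prop where
  blockN : IsBlockIdem (MonoidAlgebra k (G ⧸ N.toSubgroup)) (projN k G N e)
  defectN : IsDefectGroupF k (G ⧸ N.toSubgroup) (projN k G N e)
    (D.map (QuotientGroup.mk' N.toSubgroup))
  triv : TrivOnSimples k G e N

/-- A cofinal set of open normal subgroups. -/
def IsCofinal {G : Type} [Group G] [TopologicalSpace G]
    (𝒩 : Set (OpenNormalSubgroup G)) : Prop :=
  ∀ M : OpenNormalSubgroup G, ∃ N ∈ 𝒩, N ≤ M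

variable (k G) in
/-- A pseudocompact module is pro-uniserial (w.r.t. the cofinal system `𝒩`) if all
its coinvariant quotients at members of `𝒩` are uniserial. -/
def ProUniserial (𝒩 : Set (OpenNormalSubgroup G)) (U : Type) [AddCommGroup U]
    [Module (CGA k G) U] [TopologicalSpace U] : Prop :=
  ∀ N ∈ 𝒩, Uniserial (CGA k G) (coinv k G N U)

variable (k G) in
/-- `S` is a composition factor of the pseudocompact module `U`: it is a composition
factor of some finite coinvariant quotient `U_N`. -/
def IsCompFactorOf (U : Type) [AddCommGroup U] [Module (CGA k G) U]
    [TopologicalSpace U] (S : Type) [AddCommGroup S] [Module (CGA k G) S] : Prop :=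
  ∃ (N : OpenNormalSubgroup G) (W W' : Submodule (CGA k G) (coinv k G N U)),
    W' ≤ W ∧ Nonempty (subQuot W W' ≃ₗ[CGA k G] S)

variable (k G) in
/-- `S` is a composition factor of the finite-dimensional module `X`. -/
def IsCompFactorFin (X : Type) [AddCommGroup X] [Module (CGA k G) X]
    (S : Type) [AddCommGroup S] [Module (CGA k G) S] : Prop :=
  ∃ W W' : Submodule (CGA k G) X, W' ≤ W ∧ Nonempty (subQuot W W' ≃ₗ[CGA k G] S)

end Simples

section Projective

variable {k : Type} [Field k] {G : Type} [Group G] [TopologicalSpace G]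

variable (k G) in
/-- A pseudocompact `k⟦G⟧`-module is (categorically) projective if every continuous
surjection onto it from a pseudocompact module splits. -/
def IsPCProjective (P : Type) [AddCommGroup P] [Module (CGA k G) P]
    [TopologicalSpace P] : Prop :=
  ∀ (W : Type) [AddCommGroup W] [Module k W] [Module (CGA k G) W]
    [IsScalarTower k (CGA k G) W] [TopologicalSpace W],
    IsPseudocompactMod k (CGA k G) W →
    ∀ f : W →ₗ[CGA k G] P, Continuous f → Function.Surjective f →
      ∃ s : P →ₗ[CGA k G] W, Continuous s ∧ f.comp s = LinearMap.id

variable (k G) in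
/-- `P` is a projective cover of the simple module `S` in the block of `e`:
a pseudocompact projective module of the block together with a surjection onto `S`
whose kernel is superfluous (contained in the radical). -/
structure IsProjCover (e : CGA k G) (P : Type) [AddCommGroup P] [Module k P]
    [Module (CGA k G) P] [IsScalarTower k (CGA k G) P] [TopologicalSpace P]
    (S : Type) [AddCommGroup S] [Module (CGA k G) S] : Prop where
  pseudocompact : IsPseudocompactMod k (CGA k G) P
  inBlock : InBlock (CGA k G) (X := P) e
  projective : IsPCProjective k G P
  cover : ∃ π : P →ₗ[CGA k G] S, Function.Surjective π ∧
    LinearMap.ker π ≤ radical (CGA k G) P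

end Projective




/-- The map between subquotients induced by `f`. -/
def subQuotMap {R X Y : Type} [Ring R] [AddCommGroup X] [AddCommGroup Y] [Module R X]
    [Module R Y] (W W' : Submodule R X) (V V' : Submodule R Y) (f : X →ₗ[R] Y) :
    subQuot W W' →ₗ[R] subQuot V V' :=
  mapQ' (W'.comap W.subtype) (V'.comap V.subtype) (restrict' W V f)

/-- The conditions of Proposition 3.8 on a pair of pro-uniserial submodules `X`, `Y`
of an indecomposable projective `P`: `X ∩ Y = Soc(P)`, `X + Y = Rad(P)`, and
`Rad(P)/Soc(P) ≅ X/Soc(P) ⊕ Y/Soc(P)` with no common composition factors. -/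
def ProUniserialPair (k : Type) [Field k] (G : Type) [Group G] [TopologicalSpace G]
    (𝒩 : Set (OpenNormalSubgroup G)) (P : Type) [AddCommGroup P]
    [Module (CGA k G) P] [TopologicalSpace P]
    (X Y : Submodule (CGA k G) P) : Prop :=
  ProUniserial k G 𝒩 X ∧ ProUniserial k G 𝒩 Y ∧
  X ⊓ Y = socle (CGA k G) P ∧
  X ⊔ Y = radical (CGA k G) P ∧
  Nonempty ((subQuot (radical (CGA k G) P) (socle (CGA k G) P)) ≃ₗ[CGA k G]
    (subQuot X (socle (CGA k G) P) × subQuot Y (socle (CGA k G) P))) ∧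
  ∀ (T : Type) [AddCommGroup T] [Module (CGA k G) T], IsSimpleModule (CGA k G) T →
    ¬ (IsCompFactorOf k G (subQuot X (socle (CGA k G) P)) T ∧
       IsCompFactorOf k G (subQuot Y (socle (CGA k G) P)) T)

/-- `S : ι → Type` is a complete set of pairwise non-isomorphic representatives of
the simple modules of the block of `e`. -/
def IsSimpleReps (k : Type) [Field k] (G : Type) [Group G] [TopologicalSpace G]
    (e : CGA k G) {ι : Type} (S : ι → Type) [∀ i, AddCommGroup (S i)]
    [∀ i, Module (CGA k G) (S i)] : Prop :=
  (∀ i, IsSimpleModule (CGA k G) (S i) ∧ InBlock (CGA k G) (X := S i) e) ∧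
  (∀ i j, i ≠ j → IsEmpty (S i ≃ₗ[CGA k G] S j)) ∧
  (∀ (T : Type) [AddCommGroup T] [Module (CGA k G) T],
    IsSimpleModule (CGA k G) T → InBlock (CGA k G) (X := T) e →
      ∃ i, Nonempty (T ≃ₗ[CGA k G] S i))

section Brauer

/-- The size of the `ρ`-orbit of `i` (the number of edges at the corresponding vertex
of the Brauer tree). -/
def orbSize {ι : Type} (ρ : Equiv.Perm ι) (i : ι) : ℕ :=
  Function.minimalPeriod ρ i

/-- Data describing the exceptional vertex of a Brauer tree: `none` if there is no
exceptional vertex, and otherwise a flag recording whether it is a `ρ`-vertex or a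
`σ`-vertex together with an edge adjacent to it. -/
abbrev ExcVertex (ι : Type) : Type := Option (Bool × ι)

/-- The edge `i` is adjacent to the exceptional vertex, its `ρ`-endpoint being
exceptional. -/
def AdjExcRho {ι : Type} (ρ : Equiv.Perm ι) (exc : ExcVertex ι) (i : ι) : Prop :=
  ∃ j : ι, exc = some (true, j) ∧ ρ.SameCycle j i

/-- The edge `i` is adjacent to the exceptional vertex, its `σ`-endpoint being
exceptional. -/
def AdjExcSigma {ι : Type} (σ : Equiv.Perm ι) (exc : ExcVertex ι) (i : ι) : Prop :=
  ∃ j : ι, exc = some (false, j) ∧ σ.SameCycle j i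

/-- The edge `i` is adjacent to the exceptional vertex. -/
def AdjExc {ι : Type} (ρ σ : Equiv.Perm ι) (exc : ExcVertex ι) (i : ι) : Prop :=
  AdjExcRho ρ exc i ∨ AdjExcSigma σ exc i

end Brauer


/-- Projectivity in the category of `k[G/N]`-modules, identified with the category of
finite-dimensional `k⟦G⟧`-modules on which `N` acts trivially. -/
def IsProjectiveRelN (k : Type) [Field k] (G : Type) [Group G] [TopologicalSpace G]
    (N : OpenNormalSubgroup G) (P : Type) [AddCommGroup P] [Module (CGA k G) P] : Prop :=
  ∀ (W : Type) [AddCommGroup W] [Module k W] [Module (CGA k G) W]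
    [IsScalarTower k (CGA k G) W], Module.Finite k W → NTrivial k G N W →
    ∀ f : W →ₗ[CGA k G] P, Function.Surjective f →
      ∃ s : P →ₗ[CGA k G] W, f.comp s = LinearMap.id

section Projections

variable (k : Type) [Field k] {G : Type} [Group G] [TopologicalSpace G]

/-- The projection `k⟦G⟧ → k[G/N]` as an algebra homomorphism. -/
def projHom (N : OpenNormalSubgroup G) :
    CGA k G →ₐ[k] MonoidAlgebra k (G ⧸ N.toSubgroup) :=
  (Pi.evalAlgHom k _ N).comp (CGA k G).val

@[simp]
lemma projHom_ofG (N : OpenNormalSubgroup G) (g : G) :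
    projHom k N (ofG k G g) = MonoidAlgebra.single (g : G ⧸ N.toSubgroup) 1 := rfl

lemma tHom_projHom {M N : OpenNormalSubgroup G} (h : M ≤ N) (x : CGA k G) :
    tHom k G M N h (projHom k M x) = projHom k N x := x.2 M N h

lemma tHom_single {M N : OpenNormalSubgroup G} (h : M ≤ N) (g : G) (r : k) :
    tHom k G M N h (MonoidAlgebra.single (g : G ⧸ M.toSubgroup) r) =
      MonoidAlgebra.single (g : G ⧸ N.toSubgroup) r := by
  simp [tHom, qHom]
  rfl

lemma projHom_surjective (N : OpenNormalSubgroup G) : Function.Surjective (projHom k N) := by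
  intro x
  induction x using MonoidAlgebra.induction_linear with
  | zero => exact ⟨0, map_zero _⟩
  | add x y hx hy =>
    obtain ⟨a, rfl⟩ := hx
    obtain ⟨b, rfl⟩ := hy
    exact ⟨a + b, map_add _ _ _⟩
  | single q r =>
    obtain ⟨g, rfl⟩ := QuotientGroup.mk_surjective q
    exact ⟨r • ofG k G g, by simp⟩

variable {k}

lemma CGA.ext_projHom {x y : CGA k G} (h : ∀ N, projHom k N x = projHom k N y) : x = y :=
  Subtype.ext (funext h)

lemma projHom_eq_zero_of_le {M N : OpenNormalSubgroup G} (h : M ≤ N) {x : CGA k G}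
    (hx : projHom k M x = 0) : projHom k N x = 0 := by
  rw [← tHom_projHom k h, hx, map_zero]

end Projections

section LinearCompactness

variable {k : Type} [Field k] {G : Type} [Group G] [TopologicalSpace G]

variable (k G) in
/-- The continuous dual of `k⟦G⟧`: the functionals that factor through some `k[G/M]`. -/
def contDual : Submodule k (Module.Dual k (CGA k G)) where
  carrier := {v | ∃ M : OpenNormalSubgroup G, ∀ x, projHom k M x = 0 → v x = 0}
  add_mem' := by
    rintro v w ⟨M, hM⟩ ⟨M', hM'⟩
    refine ⟨M ⊓ M', fun x hx => ?_⟩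
    simp [hM x (projHom_eq_zero_of_le inf_le_left hx),
      hM' x (projHom_eq_zero_of_le inf_le_right hx)]
  zero_mem' := ⟨{ toSubgroup := ⊤, isOpen' := isOpen_univ }, fun _ _ => rfl⟩
  smul_mem' := by
    rintro c v ⟨M, hM⟩
    exact ⟨M, fun x hx => by simp [hM x hx]⟩

/-- A functional on a finite level, viewed in the continuous dual of `k⟦G⟧`. -/
def contDual.ofLevel (M : OpenNormalSubgroup G) :
    Module.Dual k (MonoidAlgebra k (G ⧸ M.toSubgroup)) →ₗ[k] contDual k G :=
  LinearMap.codRestrict _ (projHom k M).toLinearMap.dualMap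
    fun l => ⟨M, fun x hx => by simp [hx]⟩

lemma contDual.ofLevel_apply (M : OpenNormalSubgroup G)
    (l : Module.Dual k (MonoidAlgebra k (G ⧸ M.toSubgroup))) (x : CGA k G) :
    (contDual.ofLevel M l : Module.Dual k (CGA k G)) x = l (projHom k M x) := rfl

/-- A functional vanishing on the kernel of a linear map factors through it. -/
lemma exists_comp_eq_of_ker_le {V W : Type} [AddCommMonoid V] [AddCommMonoid W] [Module k V]
    [Module k W] (T : V →ₗ[k] W) (φ : Module.Dual k V)
    (h : ∀ v, T v = 0 → φ v = 0) : ∃ Φ : Module.Dual k W, Φ ∘ₗ T = φ := by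
  let := Module.addCommMonoidToAddCommGroup k (M := V)
  let := Module.addCommMonoidToAddCommGroup k (M := W)
  have hφ : φ ∈ LinearMap.range T.dualMap := by
    rw [LinearMap.range_dualMap_eq_dualAnnihilator_ker, Submodule.mem_dualAnnihilator]
    exact h
  exact hφ

/-- `k⟦G⟧` is reflexive: every functional on its continuous dual is an evaluation. -/
lemma contDual.exists_eval [IsTopologicalGroup G] [CompactSpace G]
    (Φ : Module.Dual k (contDual k G)) :
    ∃ c : CGA k G, ∀ v : contDual k G, Φ v = (v : Module.Dual k (CGA k G)) c := by
  have key : ∀ M : OpenNormalSubgroup G, ∃ c : MonoidAlgebra k (G ⧸ M.toSubgroup),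
      ∀ l, Φ (ofLevel M l) = l c := by
    intro M
    have : Finite (G ⧸ M.toSubgroup) := M.toSubgroup.quotient_finite_of_isOpen M.isOpen'
    have : Module.Finite k (MonoidAlgebra k (G ⧸ M.toSubgroup)) := inferInstance
    refine ⟨(Module.evalEquiv k _).symm (Φ ∘ₗ ofLevel M), fun l => ?_⟩
    rw [Module.apply_evalEquiv_symm_apply]
    rfl
  choose c hc using key
  have hcompat : c ∈ CGA k G := by
    intro M N h
    refine Module.eval_apply_injective k (LinearMap.ext fun l => ?_)
    simp only [Module.Dual.eval_apply]
    rw [← hc N l]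
    refine (hc M (l ∘ₗ (tHom k G M N h).toLinearMap)).symm.trans ?_
    congr 1
    ext x
    simp only [ofLevel_apply, LinearMap.comp_apply, ← tHom_projHom k h]
    rfl
  refine ⟨⟨c, hcompat⟩, fun v => ?_⟩
  obtain ⟨v, M, hM⟩ := v
  have hker : LinearMap.ker (projHom k M).toLinearMap ≤ LinearMap.ker v := fun x hx => hM x hx
  let l : Module.Dual k (MonoidAlgebra k (G ⧸ M.toSubgroup)) :=
    (LinearMap.ker (projHom k M).toLinearMap).liftQ v hker ∘ₗ
      ((projHom k M).toLinearMap.quotKerEquivOfSurjective (projHom_surjective k M)).symm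
  have hl : ∀ x, l (projHom k M x) = v x := by
    intro x
    have : ((projHom k M).toLinearMap.quotKerEquivOfSurjective
        (projHom_surjective k M)).symm (projHom k M x) = Submodule.Quotient.mk x := by
      rw [LinearEquiv.symm_apply_eq]
      rfl
    simp only [l, LinearMap.comp_apply, LinearEquiv.coe_coe]
    rw [this]
    rfl
  have hv : (⟨v, M, hM⟩ : contDual k G) = ofLevel M l := by
    ext x
    exact (hl x).symm
  rw [hv, hc, ofLevel_apply]
  rfl

/-- The principal left ideal `k⟦G⟧ d` is closed. -/
lemma CGA.exists_eq_mul [IsTopologicalGroup G] [CompactSpace G]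
    (N : OpenNormalSubgroup G) (d y : CGA k G)
    (h : ∀ M ≤ N, ∃ c, projHom k M y = projHom k M (c * d)) : ∃ c, y = c * d := by
  let T : contDual k G →ₗ[k] contDual k G :=
    (LinearMap.mulRight k d).dualMap.restrict (by
      rintro v ⟨M, hM⟩
      exact ⟨M, fun x hx => hM _ (by simp [hx])⟩)
  have hT : ∀ v x, (T v : Module.Dual k (CGA k G)) x = (v : Module.Dual k (CGA k G)) (x * d) :=
    fun _ _ => rfl
  let ev : Module.Dual k (contDual k G) := Module.Dual.eval k _ y ∘ₗ (contDual k G).subtype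
  have hev : ∃ Φ : Module.Dual k (contDual k G), Φ ∘ₗ T = ev := by
    refine exists_comp_eq_of_ker_le T ev ?_
    intro v hv
    obtain ⟨M, hM⟩ := v.2
    obtain ⟨c, hc⟩ := h (M ⊓ N) inf_le_right
    have h1 : (v : Module.Dual k (CGA k G)) (y - c * d) = 0 :=
      hM _ (projHom_eq_zero_of_le inf_le_left (by rw [map_sub, hc, sub_self]))
    have h2 : (v : Module.Dual k (CGA k G)) (c * d) = 0 := by
      rw [← hT, (show T v = 0 from hv)]
      rfl
    rw [map_sub, h2, sub_zero] at h1
    exact h1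
  obtain ⟨Φ, hΦ⟩ := hev
  obtain ⟨c, hc⟩ := contDual.exists_eval Φ
  refine ⟨c, CGA.ext_projHom fun M => Module.eval_apply_injective k (LinearMap.ext fun l => ?_)⟩
  simp only [Module.Dual.eval_apply]
  rw [← contDual.ofLevel_apply, ← contDual.ofLevel_apply, ← hT, ← hc]
  exact (DFunLike.congr_fun hΦ (contDual.ofLevel M l)).symm

end LinearCompactness

section GroupTheory

/-- If `F` is constant on the left cosets of `L` and `p` divides `[L : H]`, then the sum of `F`
over the cosets of `H` vanishes in characteristic `p`. -/
lemma finsum_quotient_eq_zero {G A : Type} [Group G] [AddCommMonoid A] {p : ℕ}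
    (hA : ∀ a : A, p • a = 0) {H L : Subgroup G} [Finite (G ⧸ H)] (hHL : H ≤ L)
    (F : G → A) (hF : ∀ g, ∀ l ∈ L, F (g * l) = F g) (hp : p ∣ H.relIndex L) :
    ∑ᶠ c : G ⧸ H, F (Quotient.out c) = 0 := by
  let ε := Subgroup.quotientEquivProdOfLE hHL
  have hfin : Finite ((G ⧸ L) × (L ⧸ H.subgroupOf L)) := Finite.of_equiv _ ε
  have : Finite (L ⧸ H.subgroupOf L) := Finite.of_injective
    (fun x => ((QuotientGroup.mk 1 : G ⧸ L), x)) fun x y h => congrArg Prod.snd h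
  have : Finite (G ⧸ L) := Finite.of_injective
    (fun x => (x, (QuotientGroup.mk 1 : L ⧸ H.subgroupOf L))) fun x y h => congrArg Prod.fst h
  have hout : ∀ g : G, F (Quotient.out (g : G ⧸ L)) = F g := by
    intro g
    obtain ⟨l, hl⟩ := QuotientGroup.mk_out_eq_mul L g
    rw [hl, hF _ _ l.2]
  have hval : ∀ c : G ⧸ H, F (Quotient.out c) = F (Quotient.out (ε c).1) := by
    intro c
    have : (ε c).1 = ((Quotient.out c : G) : G ⧸ L) := by
      conv_lhs => rw [← QuotientGroup.out_eq' c]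
      rfl
    rw [this, hout]
  have := Fintype.ofFinite (G ⧸ H)
  have := Fintype.ofFinite (G ⧸ L)
  have := Fintype.ofFinite (L ⧸ H.subgroupOf L)
  rw [finsum_eq_sum_of_fintype, Fintype.sum_congr _ _ hval,
    Equiv.sum_comp ε (fun x => F (Quotient.out x.1)), Fintype.sum_prod_type]
  refine Finset.sum_eq_zero fun q _ => ?_
  obtain ⟨m, hm⟩ := hp
  rw [Subgroup.relIndex, Subgroup.index, Nat.card_eq_fintype_card] at hm
  simp only [Finset.sum_const, Finset.card_univ]
  rw [hm, mul_comm, mul_nsmul', hA, nsmul_zero]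

/-- The second isomorphism theorem for indices. -/
lemma relIndex_sup_of_normal {G : Type} [Group G] (H N : Subgroup G) [N.Normal]
    [H.FiniteIndex] [N.FiniteIndex] : H.relIndex (H ⊔ N) = H.relIndex N := by
  have h1 := Subgroup.relIndex_mul_relIndex (H ⊓ N) H (H ⊔ N) inf_le_left le_sup_left
  have h2 := Subgroup.relIndex_mul_relIndex (H ⊓ N) N (H ⊔ N) inf_le_right le_sup_right
  rw [Subgroup.inf_relIndex_right, Subgroup.relIndex_sup_right, ← h1,
    Subgroup.inf_relIndex_left, mul_comm] at h2
  exact (Nat.eq_of_mul_eq_mul_left (Nat.pos_of_ne_zero fun h =>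
    Subgroup.FiniteIndex.index_ne_zero
      (zero_dvd_iff.1 (h ▸ N.relIndex_dvd_index_of_normal H))) h2).symm

/-- If `N / K` is a finite `p`-group and `p` does not divide `[N : N ∩ H]`, then `N ≤ H K`. -/
lemma le_sup_of_not_dvd_relIndex {G : Type} [Group G] {p : ℕ} [Fact p.Prime]
    (H K N : Subgroup G) [K.Normal] [K.FiniteIndex]
    (hK : ∀ n ∈ N, ∃ r : ℕ, n ^ p ^ r ∈ K) (hH : ¬ p ∣ H.relIndex N) : N ≤ H ⊔ K := by
  have hpg : IsPGroup p (N ⧸ K.subgroupOf N) := by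
    intro x
    obtain ⟨n, rfl⟩ := QuotientGroup.mk_surjective x
    obtain ⟨r, hr⟩ := hK n n.2
    refine ⟨r, ?_⟩
    rw [← QuotientGroup.mk_pow, QuotientGroup.eq_one_iff]
    exact hr
  obtain ⟨m, hm⟩ := IsPGroup.iff_card.1 hpg
  have h1 : (H ⊔ K).relIndex N ∣ p ^ m := by
    rw [← hm]
    exact Subgroup.relIndex_dvd_of_le_left N le_sup_right
  have h2 : (H ⊔ K).relIndex N ∣ H.relIndex N := Subgroup.relIndex_dvd_of_le_left N le_sup_left
  obtain ⟨i, -, hi⟩ := (Nat.dvd_prime_pow Fact.out).1 h1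
  rcases Nat.eq_zero_or_pos i with rfl | hpos
  · exact Subgroup.relIndex_eq_one.1 (by simpa using hi)
  · exact absurd ((hi ▸ dvd_pow_self p hpos.ne').trans h2) hH

end GroupTheory

section BlockAction

variable {p : ℕ} {k : Type} [Field k] [CharP k p] {G : Type} [Group G]
  [TopologicalSpace G]

lemma not_dvd_relIndex_of_mem_trImage [IsTopologicalGroup G] [CompactSpace G] {e : CGA k G}
    {N : OpenNormalSubgroup G} (H : Subgroup G) [H.FiniteIndex] (he : e ∈ trImage k G H)
    (hN : projHom k N e ≠ 0) : ¬ p ∣ H.relIndex N.toSubgroup := by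
  intro hp
  obtain ⟨b, hb, rfl⟩ := he
  have : Finite (G ⧸ N.toSubgroup) := N.toSubgroup.quotient_finite_of_isOpen N.isOpen'
  have : N.toSubgroup.FiniteIndex := Subgroup.finiteIndex_of_finite_quotient
  have hmul : ∀ g h x, conjAct k G (g * h) x = conjAct k G g (conjAct k G h x) := by
    intro g h x
    simp [conjAct, mul_assoc]
  have hNtriv : ∀ n ∈ N.toSubgroup, ∀ g, projHom k N (conjAct k G (g * n) b) =
      projHom k N (conjAct k G g b) := by
    intro n hn g
    have : ((g * n : G) : G ⧸ N.toSubgroup) = (g : G ⧸ N.toSubgroup) :=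
      (QuotientGroup.eq.2 (by simpa using hn)).symm
    have h' : (((g * n)⁻¹ : G) : G ⧸ N.toSubgroup) = ((g⁻¹ : G) : G ⧸ N.toSubgroup) := by
      rw [QuotientGroup.mk_inv, this, QuotientGroup.mk_inv]
    simp only [conjAct, map_mul (projHom k N), projHom_ofG, this, h']
  have hF : ∀ g, ∀ l ∈ H ⊔ N.toSubgroup, projHom k N (conjAct k G (g * l) b) =
      projHom k N (conjAct k G g b) := by
    intro g l hl
    obtain ⟨h, hh, n, hn, rfl⟩ := Subgroup.mem_sup_of_normal_right.1 hl
    rw [← mul_assoc, hNtriv n hn, hmul, hb h hh]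
  apply hN
  rw [trMap, map_finsum (projHom k N) (Set.toFinite _)]
  refine finsum_quotient_eq_zero (p := p) (fun a => ?_) le_sup_left
    (fun g => projHom k N (conjAct k G g b)) hF ?_
  · rw [← Nat.cast_smul_eq_nsmul k, CharP.cast_eq_zero, zero_smul]
  · rwa [relIndex_sup_of_normal]

/-- If `N` acts trivially on the simple modules of the block of `e`, then `(n - 1) e` lies in
the Jacobson radical. -/
lemma sub_one_mul_mem_jacobson {e : CGA k G} (he : IsBlockIdem (CGA k G) e)
    {N : OpenNormalSubgroup G} (hN : TrivOnSimples k G e N) {n : G} (hn : n ∈ N.toSubgroup) :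
    (ofG k G n - 1) * e ∈ Ring.jacobson (CGA k G) := by
  rw [Ring.jacobson_eq_sInf_isMaximal, Ideal.mem_sInf]
  intro I hI
  have hsimple : IsSimpleModule (CGA k G) (CGA k G ⧸ I) :=
    isSimpleModule_iff_isCoatom.2 hI.out.out
  have hcomm : ∀ a, e * a = a * e := fun a => (Set.mem_center_iff.1 he.central).comm a
  let f : (CGA k G ⧸ I) →ₗ[CGA k G] (CGA k G ⧸ I) :=
    { toFun := fun x => e • x
      map_add' := smul_add e
      map_smul' := fun a x => by simp only [smul_smul, hcomm, RingHom.id_apply] }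
  have hfx : ∀ x, f x = e • x := fun _ => rfl
  rw [← Submodule.Quotient.mk_eq_zero, ← mul_one ((ofG k G n - 1) * e), ← smul_eq_mul,
    Submodule.Quotient.mk_smul, mul_smul]
  rcases LinearMap.bijective_or_eq_zero f with hb | h0
  · have hblock : InBlock (CGA k G) (X := CGA k G ⧸ I) e := by
      intro x
      apply hb.1
      rw [hfx, hfx, smul_smul, he.idem.eq]
    rw [hblock, sub_smul, one_smul, hN _ hsimple hblock n hn, sub_self]
  · rw [← hfx, h0, LinearMap.zero_apply, smul_zero]

lemma exists_pow_mul_eq [Fact p.Prime] [IsTopologicalGroup G] [CompactSpace G] {e : CGA k G}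
    (he : IsBlockIdem (CGA k G) e) {N : OpenNormalSubgroup G} (hN : TrivOnSimples k G e N)
    (M : OpenNormalSubgroup G) {n : G} (hn : n ∈ N.toSubgroup) :
    ∃ r : ℕ, projHom k M (ofG k G (n ^ p ^ r) * e) = projHom k M e := by
  have : Finite (G ⧸ M.toSubgroup) := M.toSubgroup.quotient_finite_of_isOpen M.isOpen'
  have : Module.Finite k (MonoidAlgebra k (G ⧸ M.toSubgroup)) := inferInstance
  have : IsArtinianRing (MonoidAlgebra k (G ⧸ M.toSubgroup)) := IsArtinianRing.of_finite k _
  have : CharP (MonoidAlgebra k (G ⧸ M.toSubgroup)) p :=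
    charP_of_injective_algebraMap (algebraMap k _).injective p
  have hsurj : RingHomSurjective (projHom k M).toRingHom := ⟨projHom_surjective k M⟩
  have hmem := Ring.le_comap_jacobson (projHom k M).toRingHom
    (sub_one_mul_mem_jacobson he hN hn)
  obtain ⟨m, hm⟩ := IsSemiprimaryRing.isNilpotent (R := MonoidAlgebra k (G ⧸ M.toSubgroup))
  have hnil : (projHom k M ((ofG k G n - 1) * e)) ^ m = 0 := by
    have := Ideal.pow_mem_pow (Ideal.mem_comap.1 hmem) m
    rw [hm] at this
    exact this
  have hle : m ≤ p ^ m := (Nat.lt_pow_self (Fact.out : p.Prime).one_lt).le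
  have hnil' := pow_eq_zero_of_le hle hnil
  have hcomm : ∀ a, Commute a e := fun a => ((Set.mem_center_iff.1 he.central).comm a).symm
  rw [← map_pow, (hcomm _).mul_pow, he.idem.pow_eq (pow_ne_zero _ (Fact.out : p.Prime).ne_zero),
    map_mul, map_pow, map_sub, map_one,
    sub_pow_char_pow_of_commute _ _ (Commute.one_right _), one_pow, sub_mul, one_mul, sub_eq_zero,
    ← map_pow, ← map_pow, ← map_mul] at hnil'
  exact ⟨m, hnil'⟩

end BlockAction

section TrivialAction

variable {k : Type} [Field k] {G : Type} [Group G] [TopologicalSpace G]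

/-- A subgroup of a cyclic pro-`p` group is topologically generated by one element. -/
lemma IsCyclicProP.exists_generator {p : ℕ} [Fact p.Prime] [IsTopologicalGroup G] {D : Subgroup G}
    (hD : IsCyclicProP G p D) (N : Subgroup G) :
    ∃ d ∈ D ⊓ N, ∀ x ∈ D ⊓ N, ∀ M : OpenNormalSubgroup G, ∃ j : ℕ, x⁻¹ * d ^ j ∈ M.toSubgroup := by
  rcases hD with ⟨hfin, -, hcyc⟩ | ⟨φ, hφ⟩
  · obtain ⟨d, hd⟩ := IsCyclic.exists_generator (α := (N.subgroupOf D))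
    refine ⟨d, ⟨d.1.2, d.2⟩, fun x hx M => ?_⟩
    obtain ⟨j, hj⟩ := mem_powers_iff_mem_zpowers.2 (hd ⟨⟨x, hx.1⟩, hx.2⟩)
    refine ⟨j, ?_⟩
    have : (d : G) ^ j = x := congrArg (fun y : N.subgroupOf D => ((y : D) : G)) hj
    rw [this, inv_mul_cancel]
    exact M.toSubgroup.one_mem
  · let ψ : D ≃* Multiplicative ℤ_[p] := { φ.toEquiv with map_mul' := hφ }
    have hψ : Continuous ψ.symm := φ.symm.continuous
    obtain ⟨g, hg, hmin⟩ := (wellFounded_dvdNotUnit (α := ℤ_[p])).has_min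
      {z | (ψ.symm (Multiplicative.ofAdd z) : G) ∈ N} ⟨0, by simp [N.one_mem]⟩
    refine ⟨ψ.symm (Multiplicative.ofAdd g), ⟨Subtype.property _, hg⟩, fun x hx M => ?_⟩
    obtain ⟨w, hw⟩ : g ∣ (ψ ⟨x, hx.1⟩).toAdd := by
      by_contra hndvd
      refine hmin (ψ ⟨x, hx.1⟩).toAdd ?_ (dvdNotUnit_of_dvd_of_not_dvd
        ((ValuationRing.dvd_total g _).resolve_left hndvd) hndvd)
      simpa using hx.2
    have hcont : Continuous fun t : ℤ_[p] =>
        x⁻¹ * (ψ.symm (Multiplicative.ofAdd (g * t)) : G) :=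
      continuous_const.mul (continuous_subtype_val.comp (hψ.comp
        (continuous_ofAdd.comp (continuous_const.mul continuous_id))))
    obtain ⟨j, hj⟩ := PadicInt.denseRange_natCast.exists_mem_open
      (M.isOpen'.preimage hcont) ⟨w, by
        simp only [Set.mem_preimage]
        rw [← hw, ofAdd_toAdd, ψ.symm_apply_apply, inv_mul_cancel]
        exact M.toSubgroup.one_mem⟩
    refine ⟨j, ?_⟩
    have : (ψ.symm (Multiplicative.ofAdd g)) ^ j = ψ.symm (Multiplicative.ofAdd (g * j)) := by
      rw [← map_pow, ← ofAdd_nsmul, nsmul_eq_mul, mul_comm]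
    rw [← Subgroup.coe_pow, this]
    exact hj

variable {e : CGA k G} {D : Subgroup G} {N : OpenNormalSubgroup G}

lemma projHom_ofG_of_mem {M : OpenNormalSubgroup G} {g h : G} (hgh : g⁻¹ * h ∈ M.toSubgroup) :
    projHom k M (ofG k G g) = projHom k M (ofG k G h) := by
  rw [projHom_ofG, projHom_ofG, QuotientGroup.eq.2 hgh]

variable (k) in
/-- The elements of `N` that act trivially on the level `M` quotient of the block of `e`. -/
def trivSubgroup (e : CGA k G) (N M : OpenNormalSubgroup G) : Subgroup G where
  carrier := {g | g ∈ N.toSubgroup ∧ projHom k M (ofG k G g * e) = projHom k M e}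
  one_mem' := ⟨N.toSubgroup.one_mem, by simp⟩
  mul_mem' := by
    rintro a b ⟨ha, ha'⟩ ⟨hb, hb'⟩
    refine ⟨N.toSubgroup.mul_mem ha hb, ?_⟩
    rw [map_mul (ofG k G), mul_assoc, map_mul, hb', ← map_mul, ha']
  inv_mem' := by
    rintro a ⟨ha, ha'⟩
    refine ⟨N.toSubgroup.inv_mem ha, ?_⟩
    rw [map_mul]
    nth_rewrite 1 [← ha']
    rw [← map_mul, ← mul_assoc, ← map_mul, inv_mul_cancel, map_one, one_mul]

lemma trivSubgroup_normal (he : e ∈ Set.center (CGA k G)) (M : OpenNormalSubgroup G) :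
    (trivSubgroup k e N M).Normal where
  conj_mem := by
    rintro n ⟨hn, hn'⟩ g
    refine ⟨N.isNormal'.conj_mem n hn g, ?_⟩
    have hcomm : e * ofG k G g⁻¹ = ofG k G g⁻¹ * e := (Set.mem_center_iff.1 he).comm _
    rw [map_mul (ofG k G), map_mul (ofG k G), mul_assoc, ← hcomm, ← mul_assoc,
      mul_assoc (ofG k G g), map_mul, map_mul, hn', ← map_mul, ← map_mul, mul_assoc, hcomm,
      ← mul_assoc, ← map_mul, mul_inv_cancel, map_one, one_mul]

/-- Modulo `M`, every element of `N` acts on the block of `e` like an element of `D ∩ N`. -/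
lemma exists_mem_defect_mul_eq (p : ℕ) [Fact p.Prime] [CharP k p]
    [IsTopologicalGroup G] [CompactSpace G]
    (he : IsBlockIdem (CGA k G) e) (hD : DefectProp k G e D) (hN : TrivOnSimples k G e N)
    (hNe : projHom k N e ≠ 0) {M : OpenNormalSubgroup G} (hMN : M ≤ N) {n : G}
    (hn : n ∈ N.toSubgroup) :
    ∃ d ∈ D ⊓ N.toSubgroup, projHom k M (ofG k G n * e) = projHom k M (ofG k G d * e) := by
  have : Finite (G ⧸ M.toSubgroup) := M.toSubgroup.quotient_finite_of_isOpen M.isOpen'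
  have : M.toSubgroup.FiniteIndex := Subgroup.finiteIndex_of_finite_quotient
  have : (D ⊔ M.toSubgroup).FiniteIndex := Subgroup.finiteIndex_of_le le_sup_right
  have hMK : M.toSubgroup ≤ trivSubgroup k e N M := fun m hm => by
    refine ⟨hMN hm, ?_⟩
    rw [map_mul, projHom_ofG_of_mem (h := 1) (by simpa using hm), map_one, map_one, one_mul]
  have := trivSubgroup_normal (N := N) he.central M
  have : (trivSubgroup k e N M).FiniteIndex := Subgroup.finiteIndex_of_le hMK
  have hle := le_sup_of_not_dvd_relIndex (p := p) (D ⊔ M.toSubgroup) (trivSubgroup k e N M)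
    N.toSubgroup
    (fun n hn => by
      obtain ⟨r, hr⟩ := exists_pow_mul_eq (p := p) he hN M hn
      exact ⟨r, N.toSubgroup.pow_mem hn _, hr⟩)
    (not_dvd_relIndex_of_mem_trImage _ (hD M) hNe)
  rw [sup_assoc, sup_eq_right.2 hMK] at hle
  obtain ⟨d, hd, κ, hκ, rfl⟩ := Subgroup.mem_sup_of_normal_right.1 (hle hn)
  refine ⟨d, ⟨hd, (N.toSubgroup.mul_mem_cancel_right hκ.1).1 hn⟩, ?_⟩
  rw [map_mul (ofG k G), mul_assoc, map_mul, hκ.2, ← map_mul]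

/-- If `N ∩ D` is topologically generated by `d`, then the kernel of the projection of the block
of `e` to `k[G/N]` is contained in `k⟦G⟧ (d - 1)`. -/
lemma exists_mul_eq_mul_sub_one (p : ℕ) [Fact p.Prime] [CharP k p]
    [IsTopologicalGroup G] [CompactSpace G]
    (he : IsBlockIdem (CGA k G) e) (hD : DefectProp k G e D) (hN : TrivOnSimples k G e N)
    (hNe : projHom k N e ≠ 0) {d : G}
    (hd : ∀ x ∈ D ⊓ N.toSubgroup, ∀ M : OpenNormalSubgroup G, ∃ j : ℕ,
      x⁻¹ * d ^ j ∈ M.toSubgroup) {a : CGA k G} (ha : projHom k N a = 0) :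
    ∃ c, a * e = c * (ofG k G d - 1) := by
  refine CGA.exists_eq_mul N _ _ fun M hMN => ?_
  have hgen : ∀ n ∈ N.toSubgroup, ∃ c,
      projHom k M ((1 - ofG k G n) * e) = projHom k M (c * (ofG k G d - 1)) := by
    intro n hn
    obtain ⟨x, hx, hnx⟩ := exists_mem_defect_mul_eq p he hD hN hNe hMN hn
    obtain ⟨j, hj⟩ := hd x hx M
    refine ⟨-(e * ∑ i ∈ Finset.range j, ofG k G d ^ i), ?_⟩
    have hcomm : e * ofG k G (d ^ j) = ofG k G (d ^ j) * e :=
      (Set.mem_center_iff.1 he.central).comm _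
    rw [neg_mul, mul_assoc, geom_sum_mul, ← map_pow, mul_sub, hcomm, mul_one, sub_mul, one_mul,
      neg_sub, map_sub, map_sub, hnx, map_mul, map_mul, projHom_ofG_of_mem hj]
  let σ : G ⧸ N.toSubgroup → G ⧸ M.toSubgroup := fun q => (Quotient.out q : G)
  have key : ∀ y : MonoidAlgebra k (G ⧸ M.toSubgroup), ∃ c,
      (y - MonoidAlgebra.mapDomain σ (tHom k G M N hMN y)) * projHom k M e =
        projHom k M (c * (ofG k G d - 1)) := by
    intro y
    induction y using MonoidAlgebra.induction_linear with
    | zero => exact ⟨0, by simp⟩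
    | add y z hy hz =>
      obtain ⟨b, hb⟩ := hy
      obtain ⟨c, hc⟩ := hz
      refine ⟨b + c, ?_⟩
      rw [add_mul b c, map_add (projHom k M), ← hb, ← hc, map_add (tHom k G M N hMN),
        MonoidAlgebra.mapDomain_add, add_sub_add_comm, add_mul]
    | single q r =>
      obtain ⟨g, rfl⟩ := QuotientGroup.mk_surjective q
      obtain ⟨n, hn⟩ := QuotientGroup.mk_out_eq_mul N.toSubgroup g
      obtain ⟨c, hc⟩ := hgen n n.2
      refine ⟨r • (ofG k G g * c), ?_⟩
      have h1 : ∀ g : G, MonoidAlgebra.single (g : G ⧸ M.toSubgroup) r =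
          projHom k M (r • ofG k G g) := fun g => by simp
      rw [tHom_single, MonoidAlgebra.mapDomain_single]
      simp only [σ]
      have h2 : projHom k M (r • (ofG k G g * c) * (ofG k G d - 1)) =
          projHom k M (r • ofG k G g) * projHom k M (c * (ofG k G d - 1)) := by
        rw [← map_mul, smul_mul_assoc, smul_mul_assoc, mul_assoc]
      rw [hn, h1, h1, h2, ← hc, ← map_sub, ← map_mul, ← map_mul]
      congr 1
      rw [map_mul (ofG k G), ← smul_sub, smul_mul_assoc, smul_mul_assoc, ← mul_assoc, mul_sub,
        mul_one]
  obtain ⟨c, hc⟩ := key (projHom k M a)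
  refine ⟨c, ?_⟩
  rw [← hc, tHom_projHom, ha, map_mul]
  simp

/-- On modules of the block of `e` on which `N` acts trivially, `k⟦G⟧` acts through `k[G/N]`. -/
lemma smul_eq_zero_of_projHom_eq_zero {p : ℕ} [Fact p.Prime] [CharP k p]
    [IsTopologicalGroup G] [CompactSpace G]
    (he : IsBlockIdem (CGA k G) e) (hD : DefectProp k G e D) (hcyc : IsCyclicProP G p D)
    (hN : TrivOnSimples k G e N) (hNe : projHom k N e ≠ 0) {W : Type} [AddCommGroup W]
    [Module (CGA k G) W] (hWe : InBlock (CGA k G) (X := W) e) (hWN : NTrivial k G N W)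
    {a : CGA k G} (ha : projHom k N a = 0) (w : W) : a • w = 0 := by
  obtain ⟨d, hdN, hd⟩ := hcyc.exists_generator N.toSubgroup
  obtain ⟨c, hc⟩ := exists_mul_eq_mul_sub_one p he hD hN hNe hd ha
  rw [← hWe w, smul_smul, hc, mul_smul, sub_smul, one_smul, hWN d hdN.2, sub_self, smul_zero]

end TrivialAction

section Pseudocompact

lemma mapQ'_id_mk {R X : Type} [Ring R] [AddCommGroup X] [Module R X] {V W : Submodule R X}
    (h : V ≤ W) (x : X) :
    mapQ' V W LinearMap.id (Submodule.Quotient.mk x) = Submodule.Quotient.mk x := by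
  have h' : V ≤ W.comap LinearMap.id := h
  rw [mapQ', dif_pos h', Submodule.mapQ_apply, LinearMap.id_apply]

/-- The fibre product of two modules over a third one. -/
def fibreProd {R W X Q : Type} [Ring R] [AddCommGroup W] [AddCommGroup X] [AddCommGroup Q]
    [Module R W] [Module R X] [Module R Q] (f : W →ₗ[R] Q) (φ : X →ₗ[R] Q) :
    Submodule R (W × X) :=
  LinearMap.eqLocus (f ∘ₗ LinearMap.fst R W X) (φ ∘ₗ LinearMap.snd R W X)

lemma mem_fibreProd {R W X Q : Type} [Ring R] [AddCommGroup W] [AddCommGroup X] [AddCommGroup Q]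
    [Module R W] [Module R X] [Module R Q] {f : W →ₗ[R] Q} {φ : X →ₗ[R] Q} {z : W × X} :
    z ∈ fibreProd f φ ↔ f z.1 = φ z.2 := Iff.rfl

variable {k : Type} [Field k] {A : Type} [Ring A] [Algebra k A]
  {X : Type} [AddCommGroup X] [Module k X] [Module A X] [IsScalarTower k A X]
  {W Q : Type} [AddCommGroup W] [Module k W] [Module A W] [IsScalarTower k A W]
  [AddCommGroup Q] [Module A Q]

/-- The submodule of the fibre product with trivial first and second component in `V`. -/
def fibreProdSub (f : W →ₗ[A] Q) (φ : X →ₗ[A] Q) (V : Submodule A X) :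
    Submodule A (fibreProd f φ) :=
  LinearMap.ker ((LinearMap.id.prodMap V.mkQ) ∘ₗ (fibreProd f φ).subtype)

lemma mem_fibreProdSub {f : W →ₗ[A] Q} {φ : X →ₗ[A] Q} {V : Submodule A X}
    {z : fibreProd f φ} : z ∈ fibreProdSub f φ V ↔ z.1.1 = 0 ∧ z.1.2 ∈ V := by
  simp [fibreProdSub, Prod.ext_iff]

lemma finiteDimensional_fibreProdSub [Module.Finite k W] (f : W →ₗ[A] Q) (φ : X →ₗ[A] Q)
    {V : Submodule A X} (hV : FiniteDimensional k (X ⧸ V.restrictScalars k)) :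
    FiniteDimensional k (fibreProd f φ ⧸ (fibreProdSub f φ V).restrictScalars k) := by
  have : FiniteDimensional k (X ⧸ V) :=
    Module.Finite.equiv (Submodule.Quotient.restrictScalarsEquiv k V)
  let T : fibreProd f φ →ₗ[k] W × (X ⧸ V) :=
    ((LinearMap.id.prodMap V.mkQ) ∘ₗ (fibreProd f φ).subtype).restrictScalars k
  have hT : LinearMap.ker T = (fibreProdSub f φ V).restrictScalars k := rfl
  rw [← hT]
  exact Module.Finite.equiv T.quotKerEquivRange.symm

variable [TopologicalSpace X] [TopologicalSpace W] [DiscreteTopology W]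

lemma isOpen_fibreProdSub (f : W →ₗ[A] Q) (φ : X →ₗ[A] Q) {V : Submodule A X}
    (hV : IsOpen (V : Set X)) : IsOpen (fibreProdSub f φ V : Set (fibreProd f φ)) := by
  have : (fibreProdSub f φ V : Set (fibreProd f φ)) =
      Subtype.val ⁻¹' (({0} : Set W) ×ˢ (V : Set X)) := by
    ext z
    exact mem_fibreProdSub
  rw [this]
  exact ((isOpen_discrete _).prod hV).preimage continuous_subtype_val

variable [TopologicalSpace A]

/-- A closed submodule is the intersection of the open submodules of finite codimension
containing it. -/
lemma IsPseudocompactMod.mem_of_forall_mem_sup (hX : IsPseudocompactMod k A X)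
    {C : Submodule A X} (hC : IsClosed (C : Set X)) {x : X}
    (h : ∀ V : Submodule A X, IsOpen (V : Set X) →
      FiniteDimensional k (X ⧸ V.restrictScalars k) → x ∈ C ⊔ V) : x ∈ C := by
  have := hX.addGroup
  by_contra hx
  have hcont : Filter.Tendsto (fun y => x - y) (nhds 0) (nhds x) := by
    have h0 : Continuous fun y : X => x - y := by fun_prop
    simpa using h0.tendsto 0
  obtain ⟨V, ⟨hVo, hVf⟩, hV⟩ := hX.basis.mem_iff.1 (hcont (hC.isOpen_compl.mem_nhds hx))
  obtain ⟨c, hc, v, hv, rfl⟩ := Submodule.mem_sup.1 (h V hVo hVf)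
  exact hV hv (by simpa using hc)

/-- The fibre product of a finite-dimensional discrete module and a pseudocompact module is
pseudocompact. -/
lemma IsPseudocompactMod.fibreProd (hX : IsPseudocompactMod k A X) [Module.Finite k W]
    [ContinuousSMul A W] (f : W →ₗ[A] Q) {φ : X →ₗ[A] Q}
    (hφ : IsClosed (LinearMap.ker φ : Set X)) :
    IsPseudocompactMod k A (fibreProd f φ) := by
  have := hX.t2
  have := hX.addGroup
  have := hX.contSMul
  have hsub : ∀ U ∈ nhds (0 : ProfiniteBlocks.fibreProd f φ), ∃ V : Submodule A X,
      (IsOpen (V : Set X) ∧ FiniteDimensional k (X ⧸ V.restrictScalars k)) ∧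
      (fibreProdSub f φ V : Set (ProfiniteBlocks.fibreProd f φ)) ⊆ U := by
    intro U hU
    obtain ⟨U', hU', hUU'⟩ := mem_nhds_subtype _ _ _ |>.1 hU
    obtain ⟨s, hs, t, ht, hst⟩ := mem_nhds_prod_iff.1 hU'
    obtain ⟨V, hV, hVt⟩ := hX.basis.mem_iff.1 ht
    refine ⟨V, hV, fun z hz => hUU' (hst ⟨?_, hVt (mem_fibreProdSub.1 hz).2⟩)⟩
    rw [(mem_fibreProdSub.1 hz).1]
    exact mem_of_mem_nhds hs
  refine ⟨inferInstance, inferInstance, inferInstance, ⟨fun U => ⟨fun hU => ?_, ?_⟩⟩, ?_, ?_⟩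
  · obtain ⟨V, hV, hVU⟩ := hsub U hU
    exact ⟨_, ⟨isOpen_fibreProdSub f φ hV.1, finiteDimensional_fibreProdSub f φ hV.2⟩, hVU⟩
  · rintro ⟨V, hV, hVU⟩
    exact Filter.mem_of_superset (hV.1.mem_nhds V.zero_mem) hVU
  · refine (Submodule.eq_bot_iff _).2 fun z hz => ?_
    have hz' : ∀ V : Submodule A X, IsOpen (V : Set X) ∧
        FiniteDimensional k (X ⧸ V.restrictScalars k) → z.1.1 = 0 ∧ z.1.2 ∈ V := fun V hV => by
      simp only [Submodule.mem_iInf] at hz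
      exact mem_fibreProdSub.1 (hz (fibreProdSub f φ V)
        ⟨isOpen_fibreProdSub f φ hV.1, finiteDimensional_fibreProdSub f φ hV.2⟩)
    have hz2 : z.1.2 ∈ (⊥ : Submodule A X) := by
      rw [← hX.inf_bot]
      simp only [Submodule.mem_iInf]
      exact fun V hV => (hz' V hV).2
    obtain ⟨V, hV, -⟩ := hX.basis.mem_iff.1 Filter.univ_mem
    exact Subtype.ext (Prod.ext (hz' V hV).1 hz2)
  · intro c hc
    let E : {V : Submodule A X // IsOpen (V : Set X) ∧
        FiniteDimensional k (X ⧸ V.restrictScalars k)} →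
        {U : Submodule A (ProfiniteBlocks.fibreProd f φ) //
          IsOpen (U : Set (ProfiniteBlocks.fibreProd f φ)) ∧
          FiniteDimensional k (ProfiniteBlocks.fibreProd f φ ⧸ U.restrictScalars k)} :=
      fun V => ⟨fibreProdSub f φ V.1,
        isOpen_fibreProdSub f φ V.2.1, finiteDimensional_fibreProdSub f φ V.2.2⟩
    choose r hr using fun V => Submodule.Quotient.mk_surjective (E V).1 (c (E V))
    have hle : ∀ V V', V.1 ≤ V'.1 →
        (r V).1.1 = (r V').1.1 ∧ (r V).1.2 - (r V').1.2 ∈ V'.1 := by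
      intro V V' hVV'
      have hEE : (E V).1 ≤ (E V').1 := fun z hz =>
        mem_fibreProdSub.2 ⟨(mem_fibreProdSub.1 hz).1, hVV' (mem_fibreProdSub.1 hz).2⟩
      have := hc _ _ hEE
      rw [← hr, ← hr, mapQ'_id_mk hEE, Submodule.Quotient.eq] at this
      have := mem_fibreProdSub.1 this
      exact ⟨sub_eq_zero.1 this.1, this.2⟩
    obtain ⟨x, hx⟩ := hX.complete (fun V => Submodule.Quotient.mk (r V).1.2) fun V V' hVV' => by
      rw [mapQ'_id_mk hVV', Submodule.Quotient.eq]
      exact (hle V V' hVV').2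
    have hx' : ∀ V, (r V).1.2 - x ∈ V.1 := fun V => (Submodule.Quotient.eq _).1 (hx V)
    have htop : FiniteDimensional k (X ⧸ (⊤ : Submodule A X).restrictScalars k) := by
      rw [Submodule.restrictScalars_top]
      infer_instance
    let r₀ := r ⟨⊤, isOpen_univ, htop⟩
    have hr₀ : ∀ V, (r V).1.1 = r₀.1.1 := fun V => (hle V _ le_top).1
    have hmem : x - r₀.1.2 ∈ LinearMap.ker φ := by
      refine hX.mem_of_forall_mem_sup hφ fun V hVo hVf => ?_
      have h1 := hx' ⟨V, hVo, hVf⟩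
      have h2 := mem_fibreProd.1 (r ⟨V, hVo, hVf⟩).2
      rw [hr₀, mem_fibreProd.1 r₀.2] at h2
      rw [show x - r₀.1.2 = ((r ⟨V, hVo, hVf⟩).1.2 - r₀.1.2) +
        -((r ⟨V, hVo, hVf⟩).1.2 - x) by abel]
      refine Submodule.add_mem_sup ?_ (V.neg_mem h1)
      rw [LinearMap.mem_ker, map_sub, h2, sub_self]
    refine ⟨⟨(r₀.1.1, x), ?_⟩, fun U => ?_⟩
    · rw [LinearMap.mem_ker, map_sub, sub_eq_zero] at hmem
      exact (mem_fibreProd.1 r₀.2).trans hmem.symm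
    · obtain ⟨V, hV, hVU⟩ := hsub U.1 (U.2.1.mem_nhds U.1.zero_mem)
      rw [← hc (E ⟨V, hV⟩) U hVU, ← hr, mapQ'_id_mk hVU, Submodule.Quotient.eq]
      exact hVU (mem_fibreProdSub.2 ⟨sub_eq_zero.2 (hr₀ _), hx' ⟨V, hV⟩⟩)

end Pseudocompact

section Cover

variable {k : Type} [Field k] {A : Type} [Ring A] [Algebra k A]
  {X : Type} [AddCommGroup X] [Module k X] [Module A X] [IsScalarTower k A X]
  [TopologicalSpace X]

lemma IsPseudocompactMod.exists_isCoatom_isOpen [TopologicalSpace A]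
    (hX : IsPseudocompactMod k A X)
    {C : Submodule A X} (hC : IsClosed (C : Set X)) (hne : C ≠ ⊤) :
    ∃ M : Submodule A X, C ≤ M ∧ IsCoatom M ∧ IsOpen (M : Set X) := by
  have := hX.addGroup
  obtain ⟨x, hx⟩ : ∃ x, x ∉ C := by
    by_contra! h
    exact hne (eq_top_iff.2 fun x _ => h x)
  obtain ⟨V, hVo, hVf, hxV⟩ : ∃ V : Submodule A X, IsOpen (V : Set X) ∧
      FiniteDimensional k (X ⧸ V.restrictScalars k) ∧ x ∉ C ⊔ V := by
    by_contra! h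
    exact hx (hX.mem_of_forall_mem_sup hC h)
  have : FiniteDimensional k (X ⧸ V) :=
    Module.Finite.equiv (Submodule.Quotient.restrictScalarsEquiv k V)
  have : IsNoetherian A (X ⧸ V) := isNoetherian_of_tower k inferInstance
  obtain h | ⟨M, hM, hCM⟩ := eq_top_or_exists_le_coatom (C.map V.mkQ)
  · refine absurd ?_ hxV
    rw [sup_comm, ← Submodule.comap_map_mkQ, h]
    trivial
  · refine ⟨M.comap V.mkQ, Submodule.map_le_iff_le_comap.1 hCM,
      (Submodule.isCoatom_comap_iff V.mkQ_surjective).2 hM, ?_⟩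
    exact AddSubgroup.isOpen_mono (H₁ := V.toAddSubgroup) (H₂ := (M.comap V.mkQ).toAddSubgroup)
      (fun y hy => by simp [(Submodule.Quotient.mk_eq_zero V).2 hy]) hVo

variable {S : Type} [AddCommGroup S] [Module A S] [IsSimpleModule A S] {π : X →ₗ[A] S}

lemma eq_ker_of_isCoatom (hπ : Function.Surjective π) (hker : LinearMap.ker π ≤ radical A X)
    {M : Submodule A X} (hM : IsCoatom M) (hMo : IsOpen (M : Set X)) : M = LinearMap.ker π :=
  ((LinearMap.isCoatom_ker_of_surjective hπ).le_iff_eq hM.1).1 (hker.trans (sInf_le ⟨hM, hMo⟩))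

lemma IsPseudocompactMod.le_ker_of_isClosed [TopologicalSpace A]
    (hX : IsPseudocompactMod k A X)
    (hπ : Function.Surjective π) (hker : LinearMap.ker π ≤ radical A X)
    {C : Submodule A X} (hC : IsClosed (C : Set X)) (hne : C ≠ ⊤) : C ≤ LinearMap.ker π := by
  obtain ⟨M, hCM, hM, hMo⟩ := hX.exists_isCoatom_isOpen hC hne
  exact eq_ker_of_isCoatom hπ hker hM hMo ▸ hCM

lemma IsPseudocompactMod.isClosed_ker [TopologicalSpace A] (hX : IsPseudocompactMod k A X)
    (hπ : Function.Surjective π) (hker : LinearMap.ker π ≤ radical A X) :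
    IsClosed (LinearMap.ker π : Set X) := by
  have := hX.addGroup
  have := hX.t2
  have : Nontrivial S := IsSimpleModule.nontrivial A S
  have : Nontrivial X := hπ.nontrivial
  obtain ⟨M, -, hM, hMo⟩ := hX.exists_isCoatom_isOpen (C := ⊥) (by simp) bot_ne_top
  rw [← eq_ker_of_isCoatom hπ hker hM hMo]
  exact AddSubgroup.isClosed_of_isOpen M.toAddSubgroup hMo

/-- A quotient of a projective cover by a submodule of the maximal one is again a cover. -/
lemma ker_liftQ_le_radical (hπ : Function.Surjective π) (hker : LinearMap.ker π ≤ radical A X)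
    {C : Submodule A X} (hC : C ≤ LinearMap.ker π) :
    LinearMap.ker (C.liftQ π hC) ≤ radical A (X ⧸ C) := by
  refine le_sInf fun M hM => ?_
  have := eq_ker_of_isCoatom hπ hker
    ((Submodule.isCoatom_comap_iff C.mkQ_surjective).2 hM.1)
    (hM.2.preimage continuous_quot_mk)
  intro y hy
  obtain ⟨x, rfl⟩ := C.mkQ_surjective y
  change x ∈ M.comap C.mkQ
  rw [this]
  exact hy

lemma IsPseudocompactMod.isIndecTop_quotient [TopologicalSpace A]
    (hX : IsPseudocompactMod k A X)
    (hπ : Function.Surjective π) (hker : LinearMap.ker π ≤ radical A X)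
    {C : Submodule A X} (hC : C ≤ LinearMap.ker π) : IsIndecTop A (X ⧸ C) := by
  have : Nontrivial S := IsSimpleModule.nontrivial A S
  have hsurj : Function.Surjective (C.liftQ π hC) := fun s => by
    obtain ⟨x, rfl⟩ := hπ s
    exact ⟨C.mkQ x, rfl⟩
  refine ⟨hsurj.nontrivial, fun V W hV hW hVW => ?_⟩
  have hle : ∀ V : Submodule A (X ⧸ C), IsClosed (V : Set (X ⧸ C)) → V ≠ ⊤ →
      V ≤ LinearMap.ker (C.liftQ π hC) := by
    intro V hV hne y hy
    obtain ⟨x, rfl⟩ := C.mkQ_surjective y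
    refine hX.le_ker_of_isClosed hπ hker (C := V.comap C.mkQ)
      (hV.preimage continuous_quot_mk) (fun h => hne ?_) hy
    rw [← Submodule.map_comap_eq_of_surjective C.mkQ_surjective V, h, Submodule.map_top,
      Submodule.range_mkQ]
  by_cases hV' : V = ⊤
  · exact Or.inr (by simpa [hV'] using hVW.disjoint)
  by_cases hW' : W = ⊤
  · exact Or.inl (by simpa [hW'] using hVW.disjoint)
  have hk := sup_le (hle V hV hV') (hle W hW hW')
  rw [hVW.sup_eq_top] at hk
  obtain ⟨s, hs⟩ := exists_ne (0 : S)
  obtain ⟨y, rfl⟩ := hsurj s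
  exact absurd (hk trivial) hs

end Cover

section Projective

variable {k : Type} [Field k] {G : Type} [Group G] [TopologicalSpace G]

/-- If the kernel of `k⟦G⟧ → k[G/N]` annihilates a discrete module, then the action on it is
continuous. -/
lemma continuousSMul_of_projHom (N : OpenNormalSubgroup G) (W : Type) [AddCommGroup W]
    [Module (CGA k G) W] [TopologicalSpace W] [DiscreteTopology W]
    (h : ∀ a : CGA k G, projHom k N a = 0 → ∀ w : W, a • w = 0) :
    ContinuousSMul (CGA k G) W := by
  have hcont : Continuous (projHom k N) :=
    (continuous_apply N).comp continuous_subtype_val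
  have : DiscreteTopology (MonoidAlgebra k (G ⧸ N.toSubgroup)) := ⟨rfl⟩
  refine ⟨continuous_iff_continuousAt.2 fun ⟨a, w⟩ => ?_⟩
  have : ∀ᶠ z : CGA k G × W in nhds (a, w), a • w = z.1 • z.2 := by
    have ho : IsOpen ((projHom k N ⁻¹' {projHom k N a}) ×ˢ ({w} : Set W)) :=
      ((isOpen_discrete _).preimage hcont).prod (isOpen_discrete _)
    filter_upwards [ho.mem_nhds ⟨rfl, rfl⟩] with z hz
    obtain ⟨h1, h2⟩ := hz
    rw [Set.mem_singleton_iff.1 h2, ← sub_eq_zero, ← sub_smul]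
    refine h _ ?_ w
    rw [map_sub, Set.mem_singleton_iff.1 h1, sub_self]
  exact continuousAt_const.congr this

/-- The part of a module belonging to the block of a central idempotent. -/
def blockPart {R : Type} [Ring R] {e : R} (he : e ∈ Set.center R) (W : Type) [AddCommGroup W]
    [Module R W] : Submodule R W where
  carrier := {w | e • w = w}
  add_mem' := by
    intro a b (ha : e • a = a) (hb : e • b = b)
    change e • (a + b) = a + b
    rw [smul_add, ha, hb]
  zero_mem' := smul_zero e
  smul_mem' := by
    intro c w (hw : e • w = w)
    change e • c • w = c • w
    rw [smul_smul, (Set.mem_center_iff.1 he).comm c, mul_smul, hw]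

lemma isClosed_coinvKer (N : OpenNormalSubgroup G) (U : Type) [AddCommGroup U]
    [Module (CGA k G) U] [TopologicalSpace U] : IsClosed (coinvKer k G N U : Set U) := by
  rw [coinvKer, Submodule.coe_sInf]
  exact isClosed_biInter fun W hW => hW.1

lemma coinvKer_le_ker {N : OpenNormalSubgroup G} {U W : Type} [AddCommGroup U]
    [Module (CGA k G) U] [TopologicalSpace U] [AddCommGroup W] [Module (CGA k G) W]
    (hW : NTrivial k G N W) {g : U →ₗ[CGA k G] W} (hg : IsClosed (LinearMap.ker g : Set U)) :
    coinvKer k G N U ≤ LinearMap.ker g :=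
  sInf_le ⟨hg, fun n hn u => by
    rw [LinearMap.mem_ker, map_sub, map_smul, hW n hn, sub_self]⟩

variable {P : Type} [AddCommGroup P] [Module k P] [Module (CGA k G) P]
  [IsScalarTower k (CGA k G) P] [TopologicalSpace P]

/-- Surjections onto the coinvariants of a projective module from a finite-dimensional module
on which `k⟦G⟧` acts through `k[G/N]` split. -/
lemma IsPCProjective.exists_splitting_coinv (hP : IsPseudocompactMod k (CGA k G) P)
    (hproj : IsPCProjective k G P) {N : OpenNormalSubgroup G} {W : Type} [AddCommGroup W]
    [Module k W] [Module (CGA k G) W] [IsScalarTower k (CGA k G) W] [Module.Finite k W]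
    (hWN : NTrivial k G N W) (h : ∀ a : CGA k G, projHom k N a = 0 → ∀ w : W, a • w = 0)
    (f : W →ₗ[CGA k G] coinv k G N P) (hf : Function.Surjective f) :
    ∃ s : coinv k G N P →ₗ[CGA k G] W, f.comp s = LinearMap.id := by
  let φ := (coinvKer k G N P).mkQ
  let _ : TopologicalSpace W := ⊥
  have : DiscreteTopology W := ⟨rfl⟩
  have := continuousSMul_of_projHom N W h
  have hE : IsPseudocompactMod k (CGA k G) (fibreProd f φ) :=
    hP.fibreProd f (by rw [Submodule.ker_mkQ]; exact isClosed_coinvKer N P)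
  obtain ⟨s, hs, hs'⟩ := hproj _ hE
    (LinearMap.snd _ W P ∘ₗ (fibreProd f φ).subtype)
    (continuous_snd.comp continuous_subtype_val) (fun x => by
      obtain ⟨w, hw⟩ := hf (φ x)
      exact ⟨⟨(w, x), hw⟩, rfl⟩)
  let g : P →ₗ[CGA k G] W := LinearMap.fst _ W P ∘ₗ (fibreProd f φ).subtype ∘ₗ s
  have hg : Continuous g := continuous_fst.comp (continuous_subtype_val.comp hs)
  refine ⟨(coinvKer k G N P).liftQ g
    (coinvKer_le_ker hWN ((isClosed_discrete {(0 : W)}).preimage hg)), ?_⟩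
  refine Submodule.linearMap_qext _ (LinearMap.ext fun x => ?_)
  change f (s x).1.1 = φ x
  rw [mem_fibreProd.1 (s x).2]
  exact congrArg φ (LinearMap.congr_fun hs' x)

lemma isProjectiveRelN_coinv (hP : IsPseudocompactMod k (CGA k G) P)
    (hproj : IsPCProjective k G P) {e : CGA k G} (he : IsBlockIdem (CGA k G) e)
    (hPe : InBlock (CGA k G) (X := P) e) {N : OpenNormalSubgroup G}
    (h : ∀ (W : Type) [AddCommGroup W] [Module (CGA k G) W],
      InBlock (CGA k G) (X := W) e → NTrivial k G N W →
      ∀ a : CGA k G, projHom k N a = 0 → ∀ w : W, a • w = 0) :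
    IsProjectiveRelN k G N (coinv k G N P) := by
  intro W _ _ _ _ hfin hWN f hf
  let W' := blockPart he.central W
  have hW' : NTrivial k G N W' := fun n hn w => Subtype.ext (hWN n hn w)
  have : Module.Finite k W' := Module.Finite.of_injective
    (W'.subtype.restrictScalars k) W'.subtype_injective
  obtain ⟨s, hs⟩ := hproj.exists_splitting_coinv hP hW'
    (h W' (fun w => Subtype.ext w.2) hW') (f ∘ₗ W'.subtype) fun y => by
      obtain ⟨w, rfl⟩ := hf y
      refine ⟨⟨e • w, by
        change e • e • w = e • w
        rw [smul_smul, he.idem.eq]⟩, ?_⟩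
      obtain ⟨x, hx⟩ := (coinvKer k G N P).mkQ_surjective (f w)
      change f (e • w) = f w
      rw [map_smul, ← hx, ← map_smul, hPe]
  exact ⟨W'.subtype ∘ₗ s, hs⟩

end Projective

/-- Lemma 3.2: for a block with non-trivial cyclic defect group,
and `N` in the cofinal system `𝒩`, the coinvariant module `P_N` of the projective
cover `P` of a simple module `S` is non-zero and indecomposable; moreover it is the
projective cover of `S` as a `k[G/N]`-module. -/
theorem coinv_of_projective_cover_indecomposable
    (p : ℕ) [Fact p.Prime] (k : Type) [Field k] [CharP k p] [IsAlgClosed k]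
    (G : Type) [Group G] [TopologicalSpace G] [IsTopologicalGroup G]
    [CompactSpace G] [TotallyDisconnectedSpace G] [T2Space G]
    (e : CGA k G) (he : IsBlockIdem (CGA k G) e)
    (D : Subgroup G) (hD : IsDefectGroup k G e D)
    (hcyc : IsCyclicProP G p D) (hnt : D ≠ ⊥)
    (S : Type) [AddCommGroup S] [Module (CGA k G) S]
    (hS : IsSimpleModule (CGA k G) S) (hSe : InBlock (CGA k G) (X := S) e)
    (P : Type) [AddCommGroup P] [Module k P] [Module (CGA k G) P]
    [IsScalarTower k (CGA k G) P] [TopologicalSpace P]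
    (hP : IsProjCover k G e P S)
    (N : OpenNormalSubgroup G) (hN : GoodN k G e D N) :
    Nontrivial (coinv k G N P) ∧
    IsIndecTop (CGA k G) (coinv k G N P) ∧
    IsProjectiveRelN k G N (coinv k G N P) ∧
    ∃ π : coinv k G N P →ₗ[CGA k G] S, Function.Surjective π ∧
      LinearMap.ker π ≤ radical (CGA k G) (coinv k G N P) := by
  have hNe : projHom k N e ≠ 0 := hN.blockN.ne_zero
  obtain ⟨π, hπ, hker⟩ := hP.cover
  have hle : coinvKer k G N P ≤ LinearMap.ker π :=
    coinvKer_le_ker (hN.triv S hS hSe) (hP.pseudocompact.isClosed_ker hπ hker)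
  have hind := hP.pseudocompact.isIndecTop_quotient hπ hker hle
  refine ⟨hind.1, hind, ?_, (coinvKer k G N P).liftQ π hle, fun s => ?_,
    ker_liftQ_le_radical hπ hker hle⟩
  · exact isProjectiveRelN_coinv hP.pseudocompact hP.projective he hP.inBlock
      fun W _ _ hWe hWN a ha w =>
        smul_eq_zero_of_projHom_eq_zero he hD.defect hcyc hN.triv hNe hWe hWN ha w
  · obtain ⟨x, rfl⟩ := hπ s
    exact ⟨(coinvKer k G N P).mkQ x, rfl⟩

end ProfiniteBlocks
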